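/- For every integer k ≥ 2 and every y ∈ ℝ, the derivative of the numerator function q(y) = ∫ (x − μ₁(y))^k φ_σ(y−x) p(x) dx exists and satisfies q'(y)/p_Y(y) = −k · ψ_{k−1}(y) · μ₁'(y) + (1/σ²) · ψ_{k+1}(y) + (1/σ²) · ψ_k(y) · (μ₁(y) − y), where ψ_j(y) = (∫ (x − μ₁(y))^j φ_σ(y−x) p(x) dx)/p_Y(y) for j ≥ 1 (so ψ₁(y) = 0 and ψ_j(y) = μ_j(y) for j ≥ 2). -/

import Mathlib

open MeasureTheory Real

/-- A continuous function times an integrable function with compact support is integrable. -/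
lemma integrable_continuous_mul_of_hasCompactSupport {p g : ℝ → ℝ} (hp : Integrable p)
    (hp_supp : HasCompactSupport p) (hg : Continuous g) : Integrable (fun x => g x * p x) := by
  have h : IntegrableOn (fun x => g x * p x) (tsupport p) :=
    hp.integrableOn.continuousOn_mul hg.continuousOn hp_supp
  refine (integrableOn_iff_integrable_of_support_subset fun x hx => subset_tsupport p ?_).1 h
  exact right_ne_zero_of_mul hx

/-- Differentiation under the integral sign for a `C¹` kernel against a weight with compact
support. -/
lemma hasDerivAt_integral_kernel_mul {p h φ φ' : ℝ → ℝ} (hp : Integrable p)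
    (hp_supp : HasCompactSupport p) (hh : Continuous h)
    (hφ : ∀ t, HasDerivAt φ (φ' t) t) (hφ' : Continuous φ') (y : ℝ) :
    HasDerivAt (fun y => ∫ x, h x * φ (y - x) * p x) (∫ x, h x * φ' (y - x) * p x) y := by
  have hφc : Continuous φ := continuous_iff_continuousAt.2 fun t => (hφ t).continuousAt
  obtain ⟨C, hC⟩ := ((isCompact_closedBall y 1).prod hp_supp).exists_bound_of_continuousOn
    (f := fun z : ℝ × ℝ => h z.2 * φ' (z.1 - z.2)) (by fun_prop)
  have hI : ∀ z, Integrable (fun x => h x * φ (z - x) * p x) := fun z =>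
    integrable_continuous_mul_of_hasCompactSupport hp hp_supp (by fun_prop)
  refine (hasDerivAt_integral_of_dominated_loc_of_deriv_le (bound := fun x => C * ‖p x‖)
    (F' := fun z x => h x * φ' (z - x) * p x)
    (Metric.ball_mem_nhds y one_pos) (.of_forall fun z => (hI z).aestronglyMeasurable) (hI y)
    (integrable_continuous_mul_of_hasCompactSupport hp hp_supp
      (by fun_prop)).aestronglyMeasurable
    (.of_forall fun x z hz => ?_) (hp.norm.const_mul C) (.of_forall fun x z _ => ?_)).2
  · by_cases hx : x ∈ tsupport p
    · rw [norm_mul]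
      exact mul_le_mul_of_nonneg_right (hC (z, x) ⟨Metric.ball_subset_closedBall hz, hx⟩)
        (norm_nonneg _)
    · simp [image_eq_zero_of_notMem_tsupport hx]
  · exact (((hφ (z - x)).comp_sub_const z x).const_mul (h x)).mul_const (p x)

/-- Derivative of a moment about a moving centre `m`, where only differentiability of `m` at the
point is required. -/
lemma hasDerivAt_integral_sub_pow_mul_kernel_mul {p φ φ' m : ℝ → ℝ} {m' y : ℝ}
    (hp : Integrable p) (hp_supp : HasCompactSupport p)
    (hφ : ∀ t, HasDerivAt φ (φ' t) t) (hφ' : Continuous φ') (hm : HasDerivAt m m' y) (k : ℕ) :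
    ∀ {h : ℝ → ℝ}, Continuous h →
      HasDerivAt (fun z => ∫ x, h x * (x - m z) ^ k * φ (z - x) * p x)
        (∫ x, h x * (-(k * (x - m y) ^ (k - 1) * m') * φ (y - x) +
          (x - m y) ^ k * φ' (y - x)) * p x) y := by
  have hφc : Continuous φ := continuous_iff_continuousAt.2 fun t => (hφ t).continuousAt
  have hI {g : ℝ → ℝ} (hg : Continuous g) : Integrable (fun x => g x * p x) :=
    integrable_continuous_mul_of_hasCompactSupport hp hp_supp hg
  induction k with
  | zero =>
    intro h hh
    simpa using hasDerivAt_integral_kernel_mul hp hp_supp hh hφ hφ' y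
  | succ k ih =>
    intro h hh
    have key := (ih (h := fun x => x * h x) (by fun_prop)).sub (hm.mul (ih hh))
    refine (key.congr_of_eventuallyEq (.of_forall fun z => ?_)).congr_deriv ?_
    · simp only [Pi.sub_apply, Pi.mul_apply]
      rw [← integral_const_mul, ← integral_sub (hI (by fun_prop))
        ((hI (by fun_prop)).const_mul _)]
      congr 1 with x
      ring
    · rw [← integral_const_mul, ← integral_const_mul,
        ← integral_add ((hI (by fun_prop)).const_mul _) ((hI (by fun_prop)).const_mul _),
        ← integral_sub (hI (by fun_prop)) (((hI (by fun_prop)).const_mul _).fun_add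
          ((hI (by fun_prop)).const_mul _))]
      congr 1 with x
      cases k with
      | zero => simp; ring
      | succ k => simp only [Nat.add_sub_cancel]; push_cast; ring

open MeasureTheory Real

/-- For every `k ≥ 2` and every `y`, the numerator `q_k(y) = ∫ (x − μ₁ y)^k φ_σ(y−x) p(x) dx`
is differentiable at `y` and
`q_k'(y)/pY(y) = −k ψ_{k−1}(y) μ₁'(y) + (1/σ²) ψ_{k+1}(y) + (1/σ²) ψ_k(y) (μ₁(y) − y)`,
where `ψ_j(y) = (∫ (x − μ₁ y)^j φ_σ(y−x) p(x) dx)/pY(y)` for `j ≥ 1`. -/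
theorem deriv_central_moment_numerator
    (σ : ℝ) (hσ : 0 < σ)
    (p : ℝ → ℝ) (hp_meas : Measurable p) (hp_nonneg : ∀ x, 0 ≤ p x)
    (hp_bdd : ∃ C, ∀ x, p x ≤ C) (hp_supp : HasCompactSupport p)
    (hp_int : ∫ x, p x = 1)
    (φ : ℝ → ℝ)
    (hφ : ∀ t, φ t = (2 * π * σ ^ 2) ^ (-(1 : ℝ) / 2) * Real.exp (-t ^ 2 / (2 * σ ^ 2)))
    (pY : ℝ → ℝ) (hpY : ∀ y, pY y = ∫ x, φ (y - x) * p x)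
    (hpY_pos : ∀ y, 0 < pY y)
    (μ₁ : ℝ → ℝ) (hμ₁ : ∀ y, μ₁ y = (∫ x, x * φ (y - x) * p x) / pY y)
    (hμ₁_diff : Differentiable ℝ μ₁)
    (Q : ℕ → ℝ → ℝ)
    (hQ : ∀ (k : ℕ) (y : ℝ), Q k y = ∫ x, (x - μ₁ y) ^ k * φ (y - x) * p x)
    (ψ : ℕ → ℝ → ℝ)
    (hψ : ∀ j, 1 ≤ j → ∀ y, ψ j y = (∫ x, (x - μ₁ y) ^ j * φ (y - x) * p x) / pY y) :
    ∀ k : ℕ, 2 ≤ k → ∀ y : ℝ,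
      DifferentiableAt ℝ (Q k) y ∧
      deriv (Q k) y / pY y =
        -(k : ℝ) * ψ (k - 1) y * deriv μ₁ y +
        (1 / σ ^ 2) * ψ (k + 1) y +
        (1 / σ ^ 2) * ψ k y * (μ₁ y - y) := by
  intro k hk y
  have hp : Integrable p := .of_integral_ne_zero (by simp [hp_int])
  have hφ_deriv : ∀ t, HasDerivAt φ (-t / σ ^ 2 * φ t) t := by
    intro t
    rw [funext hφ]
    have h := (((hasDerivAt_id t).pow 2).neg.div_const (2 * σ ^ 2)).exp.const_mul
      ((2 * π * σ ^ 2) ^ (-(1 : ℝ) / 2))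
    refine h.congr_deriv ?_
    simp
    field_simp
  have hφc : Continuous φ := continuous_iff_continuousAt.2 fun t => (hφ_deriv t).continuousAt
  have hI (j : ℕ) : Integrable (fun x => (x - μ₁ y) ^ j * φ (y - x) * p x) :=
    integrable_continuous_mul_of_hasCompactSupport hp hp_supp (by fun_prop)
  have key : HasDerivAt (Q k) (-(k : ℝ) * deriv μ₁ y * Q (k - 1) y +
      (1 / σ ^ 2 * Q (k + 1) y + 1 / σ ^ 2 * (μ₁ y - y) * Q k y)) y := by
    have h := hasDerivAt_integral_sub_pow_mul_kernel_mul hp hp_supp hφ_deriv (by fun_prop)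
      (hμ₁_diff y).hasDerivAt k (continuous_const (y := (1 : ℝ)))
    simp only [one_mul] at h
    rw [funext (hQ k)]
    refine h.congr_deriv (Eq.symm ?_)
    simp only [hQ]
    rw [← integral_const_mul, ← integral_const_mul, ← integral_const_mul,
      ← integral_add ((hI _).const_mul _) ((hI _).const_mul _),
      ← integral_add ((hI _).const_mul _) (((hI _).const_mul _).fun_add ((hI _).const_mul _))]
    congr 1 with x
    ring
  refine ⟨key.differentiableAt, ?_⟩
  rw [key.deriv, hψ (k - 1) (by omega), hψ (k + 1) (by omega), hψ k (by omega),
    ← hQ, ← hQ, ← hQ]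
  ring
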